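/- arXiv:2204.09253 — 3 statements merged into one kernel-verified Lean document; each statement's English description precedes it below -/
import Mathlib

section
/- Let X be a real Hilbert space, T > 0, I = (0,T), and 1 ≤ p ≤ ∞. Let 0 < m ≤ M, let a be an admissible bilinear form, j an admissible functional, f ∈ W^{1,p}(I;X*) with derivative ḟ, and let u_* ∈ X satisfy a(u_*, v) + j(v) ≥ ⟨f(0), v⟩ for all v ∈ X. Then there exists a solution u ∈ W^{1,p}(I;X) of the quasistatic variational inequality with data (a, j, f, u_*). -/
open MeasureTheory Set Filter
open scoped ENNReal NNReal Topology

noncomputable section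

/-- `u : [0,T] → E` belongs to `W^{1,p}((0,T); E)` with derivative `du`:
`du` is strongly measurable on `(0,T)` with finite `L^p` norm, and
`u t = u 0 + ∫₀ᵗ du` (Bochner integral) for every `t ∈ [0,T]`. -/
def MemW1p {E : Type*} [NormedAddCommGroup E] [NormedSpace ℝ E]
    (T : ℝ) (p : ℝ≥0∞) (u du : ℝ → E) : Prop :=
  AEStronglyMeasurable du (volume.restrict (Ioo 0 T)) ∧
  eLpNorm du p (volume.restrict (Ioo 0 T)) < ⊤ ∧
  ∀ t ∈ Icc (0 : ℝ) T, u t = u 0 + ∫ s in (0 : ℝ)..t, du s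

/-- An admissible bilinear form on a Hilbert space `X`: symmetric, bilinear,
coercive with constant `m` and bounded with constant `M`. -/
def AdmissibleForm {X : Type*} [NormedAddCommGroup X] [InnerProductSpace ℝ X]
    (m M : ℝ) (a : X → X → ℝ) : Prop :=
  (∀ v w, a v w = a w v) ∧
  (∀ v w z, a (v + w) z = a v z + a w z) ∧
  (∀ (c : ℝ) (v w : X), a (c • v) w = c * a v w) ∧
  (∀ v, m * ‖v‖ ^ 2 ≤ a v v) ∧
  (∀ v w, |a v w| ≤ M * ‖v‖ * ‖w‖)

/-- An admissible functional on `X`: nonnegative, convex, positively homogeneous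
and Lipschitz continuous. -/
def AdmissibleJ {X : Type*} [NormedAddCommGroup X] [InnerProductSpace ℝ X]
    (j : X → ℝ) : Prop :=
  (∀ v, 0 ≤ j v) ∧ ConvexOn ℝ univ j ∧
  (∀ (c : ℝ) (v : X), j (c • v) = |c| * j v) ∧
  (∃ L : ℝ≥0, LipschitzWith L j)

/-- `u` (with derivative `du`) is a solution of the quasistatic variational
inequality with data `(a, j, f, ustar)`. -/
def IsQVISol {X : Type*} [NormedAddCommGroup X] [InnerProductSpace ℝ X]
    (T : ℝ) (p : ℝ≥0∞) (a : X → X → ℝ) (j : X → ℝ)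
    (f : ℝ → (X →L[ℝ] ℝ)) (ustar : X) (u du : ℝ → X) : Prop :=
  MemW1p T p u du ∧ u 0 = ustar ∧
  ∀ᵐ t ∂(volume.restrict (Ioo 0 T)), ∀ v : X,
    a (u t) (v - du t) + j v - j (du t) ≥ (f t) (v - du t)

section CatchUp

variable {Y : Type*} [NormedAddCommGroup Y] [InnerProductSpace ℝ Y]

/-- `u` is a discrete trajectory of the catching-up algorithm for the input `G` and the
constraint set `K`: the slack `G k - u k` stays in `K`, and every increment of `u` lies in the
normal cone of `K` at the new slack. -/
structure IsCatchUp (K : Set Y) (G u : ℕ → Y) : Prop where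
  mem : ∀ k, G k - u k ∈ K
  inner_nonneg : ∀ k, ∀ z ∈ K, 0 ≤ inner ℝ (G (k + 1) - u (k + 1) - z) (u (k + 1) - u k)

theorem exists_isCatchUp [CompleteSpace Y] {K : Set Y} (hKc : IsClosed K) (hK : Convex ℝ K)
    (G : ℕ → Y) (u₀ : Y) (h₀ : G 0 - u₀ ∈ K) : ∃ u : ℕ → Y, u 0 = u₀ ∧ IsCatchUp K G u := by
  have hproj : ∀ y : Y, ∃ w ∈ K, ∀ z ∈ K, inner ℝ (y - w) (z - w) ≤ 0 := by
    intro y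
    obtain ⟨w, hw, hmin⟩ :=
      exists_norm_eq_iInf_of_complete_convex ⟨_, h₀⟩ hKc.isComplete hK y
    exact ⟨w, hw, (norm_eq_iInf_iff_real_inner_le_zero hK hw).1 hmin⟩
  choose P hPK hP using hproj
  let u : ℕ → Y := fun n => Nat.rec u₀ (fun k v => G (k + 1) - P (G (k + 1) - v)) n
  have hu : ∀ k, u (k + 1) = G (k + 1) - P (G (k + 1) - u k) := fun k => rfl
  refine ⟨u, rfl, fun k => ?_, fun k z hz => ?_⟩
  · cases k with
    | zero => exact h₀
    | succ k => rw [hu, sub_sub_cancel]; exact hPK _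
  · have h := hP (G (k + 1) - u k) z hz
    rw [hu, sub_sub_cancel, ← neg_sub z, inner_neg_left, real_inner_comm]
    rw [sub_right_comm] at h
    linarith

namespace IsCatchUp

variable {K : Set Y} {G u : ℕ → Y}

theorem norm_step_le (h : IsCatchUp K G u) (k : ℕ) :
    ‖u (k + 1) - u k‖ ≤ ‖G (k + 1) - G k‖ := by
  have h1 := h.inner_nonneg k _ (h.mem k)
  have h2 : G (k + 1) - u (k + 1) - (G k - u k) = (G (k + 1) - G k) - (u (k + 1) - u k) := by
    abel
  rw [h2, inner_sub_left, real_inner_self_eq_norm_sq] at h1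
  have h3 := real_inner_le_norm (G (k + 1) - G k) (u (k + 1) - u k)
  by_contra! hlt
  nlinarith [norm_nonneg (u (k + 1) - u k), norm_nonneg (G (k + 1) - G k)]

theorem norm_sub_le (h : IsCatchUp K G u) {V : ℕ → ℝ}
    (hV : ∀ k, ‖G (k + 1) - G k‖ ≤ V (k + 1) - V k) {k l : ℕ} (hkl : k ≤ l) :
    ‖u l - u k‖ ≤ V l - V k := by
  induction l, hkl using Nat.le_induction with
  | base => simp
  | succ l _ ih =>
    have h1 := (h.norm_step_le l).trans (hV l)
    have h2 := norm_sub_le_norm_sub_add_norm_sub (u (l + 1)) (u l) (u k)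
    linarith

/-- Slowing down the input by a constant factor slows down the trajectory. -/
theorem comp_div (h : IsCatchUp K G u) {q : ℕ} :
    IsCatchUp K (fun k => G (k / q)) (fun k => u (k / q)) := by
  refine ⟨fun k => h.mem _, fun k z hz => ?_⟩
  have hdiv : (k + 1) / q = k / q ∨ (k + 1) / q = k / q + 1 := by
    rw [Nat.succ_div]; split_ifs <;> simp
  rcases hdiv with h1 | h1
  · simp only [h1, sub_self, inner_zero_right, le_refl]
  · simp only [h1]
    exact h.inner_nonneg _ z hz

theorem sq_norm_sub_le {G' u' : ℕ → Y} (h : IsCatchUp K G u) (h' : IsCatchUp K G' u')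
    (h₀ : u 0 = u' 0) {V V' : ℕ → ℝ}
    (hV : ∀ k, ‖G (k + 1) - G k‖ ≤ V (k + 1) - V k)
    (hV' : ∀ k, ‖G' (k + 1) - G' k‖ ≤ V' (k + 1) - V' k) {ε : ℝ} (hε : 0 ≤ ε) (n : ℕ)
    (hG : ∀ k ≤ n, ‖G k - G' k‖ ≤ ε) :
    ‖u n - u' n‖ ^ 2 ≤ 2 * ε * ((V n - V 0) + (V' n - V' 0)) := by
  induction n with
  | zero => simp [h₀]
  | succ n ih =>
    have ih := ih fun k hk => hG k (hk.trans n.le_succ)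
    have h1 := h.inner_nonneg n _ (h'.mem (n + 1))
    have h2 := h'.inner_nonneg n _ (h.mem (n + 1))
    have hs := (h.norm_step_le n).trans (hV n)
    have hs' := (h'.norm_step_le n).trans (hV' n)
    set d := u (n + 1) - u' (n + 1) with hd
    set e := G (n + 1) - G' (n + 1) with he
    set x := u (n + 1) - u n with hx
    set y := u' (n + 1) - u' n with hy
    have e1 : G (n + 1) - u (n + 1) - (G' (n + 1) - u' (n + 1)) = e - d := by
      rw [hd, he]; abel
    have e2 : G' (n + 1) - u' (n + 1) - (G (n + 1) - u (n + 1)) = -(e - d) := by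
      rw [hd, he]; abel
    rw [e1] at h1
    rw [e2, inner_neg_left] at h2
    have e3 : u n - u' n = d - (x - y) := by rw [hd, hx, hy]; abel
    have h3 : inner ℝ d (x - y) ≤ inner ℝ e (x - y) := by
      simp only [inner_sub_left, inner_sub_right] at h1 h2 ⊢
      linarith
    have h4 : inner ℝ e (x - y) ≤ ε * ((V (n + 1) - V n) + (V' (n + 1) - V' n)) := by
      refine (real_inner_le_norm _ _).trans ?_
      gcongr
      · exact hG _ le_rfl
      · exact (_root_.norm_sub_le _ _).trans (add_le_add hs hs')
    have h5 := norm_sub_sq_real d (x - y)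
    rw [e3] at ih
    nlinarith [sq_nonneg ‖x - y‖]

theorem neg_le_inner (h : IsCatchUp K G u) {V : ℕ → ℝ}
    (hV : ∀ k, ‖G (k + 1) - G k‖ ≤ V (k + 1) - V k) {z : Y} (hz : z ∈ K) {k l : ℕ}
    (hkl : k ≤ l) (hVG : ∀ l, k ≤ l → ‖G l - G k‖ ≤ V l - V k) :
    -(2 * (V l - V k) ^ 2) ≤ inner ℝ (G k - u k - z) (u l - u k) := by
  induction l, hkl using Nat.le_induction with
  | base => simp
  | succ l hkl ih =>
    have h1 := h.inner_nonneg l z hz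
    have hs := (h.norm_step_le l).trans (hV l)
    have hu := h.norm_sub_le hV (hkl.trans l.le_succ)
    have hG := hVG _ (hkl.trans l.le_succ)
    have hu0 := (norm_nonneg _).trans (h.norm_sub_le hV hkl)
    have e1 : G (l + 1) - u (l + 1) - z
        = (G k - u k - z) + ((G (l + 1) - G k) - (u (l + 1) - u k)) := by abel
    rw [e1, inner_add_left] at h1
    have h2 : inner ℝ ((G (l + 1) - G k) - (u (l + 1) - u k)) (u (l + 1) - u l)
        ≤ ((V (l + 1) - V k) + (V (l + 1) - V k)) * (V (l + 1) - V l) := by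
      refine (real_inner_le_norm _ _).trans ?_
      gcongr
      · linarith [norm_nonneg (G (l + 1) - G k)]
      · exact (_root_.norm_sub_le _ _).trans (add_le_add hG hu)
    have e2 : u (l + 1) - u k = (u l - u k) + (u (l + 1) - u l) := by abel
    rw [e2, inner_add_right]
    have hVl := (norm_nonneg _).trans hs
    nlinarith

end IsCatchUp

end CatchUp

section ContinuousTime

variable {Y : Type*} [NormedAddCommGroup Y] [InnerProductSpace ℝ Y]

theorem Real.tendsto_floor_mul_two_pow_div {t : ℝ} (ht : 0 ≤ t) :
    Tendsto (fun n : ℕ => (⌊t * 2 ^ n⌋₊ : ℝ) / 2 ^ n) atTop (𝓝 t) := by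
  have h2 : Tendsto (fun n : ℕ => (2 : ℝ) ^ n) atTop atTop :=
    tendsto_pow_atTop_atTop_of_one_lt one_lt_two
  exact (tendsto_nat_floor_mul_div_atTop ht).comp h2

/-- Limits of catching-up trajectories along dyadic meshes. -/
theorem exists_play [CompleteSpace Y] {K : Set Y} (hKc : IsClosed K) (hK : Convex ℝ K)
    {F : ℝ → Y} {G : ℝ → ℝ} (hG : Continuous G)
    (hFG : ∀ s t, s ≤ t → ‖F t - F s‖ ≤ G t - G s) (u₀ : Y) (h₀ : F 0 - u₀ ∈ K) :
    ∃ u : ℝ → Y, u 0 = u₀ ∧ (∀ t, 0 ≤ t → F t - u t ∈ K) ∧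
      (∀ s t, 0 ≤ s → s ≤ t → ‖u t - u s‖ ≤ G t - G s) ∧
      ∀ s t, 0 ≤ s → s ≤ t → ∀ z ∈ K,
        -(2 * (G t - G s) ^ 2) ≤ inner ℝ (F s - u s - z) (u t - u s) := by
  have hGm : Monotone G := fun s t hst => by linarith [(norm_nonneg _).trans (hFG s t hst)]
  have hF : Continuous F := by
    refine continuous_iff_continuousAt.2 fun t => ?_
    rw [ContinuousAt, tendsto_iff_norm_sub_tendsto_zero]
    have h1 : Tendsto (fun s => |G s - G t|) (𝓝 t) (𝓝 0) := by
      have : Continuous fun s => |G s - G t| := by fun_prop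
      simpa using this.tendsto t
    refine squeeze_zero (fun _ => norm_nonneg _) (fun s => ?_) h1
    rcases le_total t s with h | h
    · exact (hFG _ _ h).trans (le_abs_self _)
    · rw [norm_sub_rev, abs_sub_comm]
      exact (hFG _ _ h).trans (le_abs_self _)
  let τ : ℕ → ℕ → ℝ := fun n k => (k : ℝ) / 2 ^ n
  have hτm : ∀ n, Monotone (τ n) := fun n k l hkl => by
    simp only [τ]; gcongr
  have hτ0 : ∀ n, τ n 0 = 0 := fun n => by simp [τ]
  have hex : ∀ n, ∃ U : ℕ → Y, U 0 = u₀ ∧ IsCatchUp K (fun k => F (τ n k)) U := fun n =>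
    exists_isCatchUp hKc hK _ u₀ (by simpa [hτ0] using h₀)
  choose U hU0 hU using hex
  have hV : ∀ n k l, k ≤ l → ‖F (τ n l) - F (τ n k)‖ ≤ G (τ n l) - G (τ n k) :=
    fun n k l hkl => hFG _ _ (hτm n hkl)
  let κ : ℝ → ℕ → ℕ := fun t n => ⌊t * 2 ^ n⌋₊
  have hκm : ∀ {s t : ℝ}, s ≤ t → ∀ n, κ s n ≤ κ t n := fun hst n =>
    Nat.floor_le_floor (by gcongr)
  have hκ : ∀ t, 0 ≤ t → Tendsto (fun n => τ n (κ t n)) atTop (𝓝 t) := fun t ht =>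
    Real.tendsto_floor_mul_two_pow_div ht
  have hκt : ∀ t, 0 ≤ t → ∀ n, τ n (κ t n) ≤ t := fun t ht n => by
    simp only [τ, κ]
    rw [div_le_iff₀ (by positivity)]
    exact Nat.floor_le (by positivity)
  have hcauchy : ∀ t, 0 ≤ t → CauchySeq fun n => U n (κ t n) := by
    intro t ht
    rw [Metric.cauchySeq_iff']
    intro ε hε
    set C : ℝ := 4 * (G t - G 0) + 1
    have hC : 0 < C := by have := hGm ht; simp only [C]; linarith
    obtain ⟨δ, hδ, hδG⟩ := Metric.uniformContinuousOn_iff.1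
      (isCompact_Icc.uniformContinuousOn_of_continuous (hG.continuousOn (s := Icc 0 t)))
      (ε ^ 2 / C) (by positivity)
    obtain ⟨N, hN⟩ := exists_pow_lt_of_lt_one hδ (by norm_num : (1 / 2 : ℝ) < 1)
    refine ⟨N, fun n hn => ?_⟩
    obtain ⟨r, rfl⟩ := Nat.exists_eq_add_of_le hn
    have hcast : κ t (N + r) / 2 ^ r = κ t N := by
      simp only [κ]
      have := Nat.floor_div_natCast (t * 2 ^ (N + r)) (2 ^ r)
      rw [← this]
      congr 1
      push_cast
      rw [pow_add]
      field_simp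
    have hcmp := (hU (N + r)).sq_norm_sub_le ((hU N).comp_div (q := 2 ^ r))
      (by simp [hU0]) (V := fun k => G (τ (N + r) k)) (V' := fun k => G (τ N (k / 2 ^ r)))
      (fun k => hV _ _ _ k.le_succ)
      (fun k => hV _ _ _ (Nat.div_le_div_right k.le_succ)) (ε := ε ^ 2 / C) (by positivity)
      (κ t (N + r)) (fun k hk => ?_)
    · simp only [hcast, hτ0, Nat.zero_div] at hcmp
      have b1 := hGm (hκt t ht (N + r))
      have b2 := hGm (hκt t ht N)
      have b3 : 2 * (ε ^ 2 / C) * (G (τ (N + r) (κ t (N + r))) - G 0 + (G (τ N (κ t N)) - G 0))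
          ≤ 2 * (ε ^ 2 / C) * (2 * (G t - G 0)) := by
        gcongr; linarith
      have b4 : 2 * (ε ^ 2 / C) * (2 * (G t - G 0)) < ε ^ 2 := by
        have : 2 * (ε ^ 2 / C) * (2 * (G t - G 0)) = ε ^ 2 * ((C - 1) / C) := by
          simp only [C]; ring
        rw [this]
        have h1 : (C - 1) / C < 1 := by rw [div_lt_one hC]; linarith
        have h2 : 0 < ε ^ 2 := by positivity
        nlinarith
      rw [dist_eq_norm]
      exact lt_of_pow_lt_pow_left₀ 2 hε.le ((hcmp.trans b3).trans_lt b4)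
    · have hle : τ N (k / 2 ^ r) ≤ τ (N + r) k := by
        simp only [τ]
        rw [pow_add, mul_comm, ← div_div]
        gcongr
        exact_mod_cast Nat.cast_div_le (α := ℝ) (m := k) (n := 2 ^ r)
      have hlt : τ (N + r) k - τ N (k / 2 ^ r) < δ := by
        refine lt_of_le_of_lt ?_ hN
        simp only [τ]
        have h1 : (k : ℝ) / 2 ^ r ≤ ((k / 2 ^ r : ℕ) : ℝ) + 1 := by
          have := (Nat.lt_floor_add_one ((k : ℝ) / 2 ^ r)).le
          have h2 := Nat.floor_div_eq_div (K := ℝ) k (2 ^ r)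
          push_cast at h2
          rwa [h2] at this
        rw [pow_add, mul_comm, ← div_div, ← sub_div, one_div, inv_pow, div_eq_mul_inv]
        refine mul_le_of_le_one_left (by positivity) (by linarith)
      have hkt : τ (N + r) k ≤ t := (hτm _ hk).trans (hκt t ht _)
      have h0 : 0 ≤ τ N (k / 2 ^ r) := by simp only [τ]; positivity
      refine (hFG _ _ hle).trans ?_
      have := hδG _ ⟨h0.trans hle, hkt⟩ _ ⟨h0, hle.trans hkt⟩
        (by rw [Real.dist_eq, abs_of_nonneg (by linarith)]; exact hlt)
      rw [Real.dist_eq] at this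
      exact (le_abs_self _).trans this.le
  have hlim : ∀ t, ∃ y, 0 ≤ t → Tendsto (fun n => U n (κ t n)) atTop (𝓝 y) := fun t => by
    by_cases ht : 0 ≤ t
    · obtain ⟨y, hy⟩ := cauchySeq_tendsto_of_complete (hcauchy t ht)
      exact ⟨y, fun _ => hy⟩
    · exact ⟨0, fun h => absurd h ht⟩
  choose u hu using hlim
  have hFl : ∀ t, 0 ≤ t → Tendsto (fun n => F (τ n (κ t n))) atTop (𝓝 (F t)) := fun t ht =>
    (hF.tendsto t).comp (hκ t ht)
  have hGl : ∀ t, 0 ≤ t → Tendsto (fun n => G (τ n (κ t n))) atTop (𝓝 (G t)) := fun t ht =>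
    (hG.tendsto t).comp (hκ t ht)
  refine ⟨u, ?_, fun t ht => ?_, fun s t hs hst => ?_, fun s t hs hst z hz => ?_⟩
  · refine tendsto_nhds_unique (hu 0 le_rfl) ?_
    simp [κ, hU0]
  · exact hKc.mem_of_tendsto ((hFl t ht).sub (hu t ht)) (.of_forall fun n => (hU n).mem _)
  · refine le_of_tendsto_of_tendsto' ((hu t (hs.trans hst)).sub (hu s hs)).norm
      ((hGl t (hs.trans hst)).sub (hGl s hs)) fun n => ?_
    exact (hU n).norm_sub_le (V := fun k => G (τ n k)) (fun k => hV _ _ _ k.le_succ) (hκm hst n)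
  · refine le_of_tendsto_of_tendsto'
      ((((hGl t (hs.trans hst)).sub (hGl s hs)).pow 2).const_mul 2).neg
      ((((hFl s hs).sub (hu s hs)).sub_const z).inner ((hu t (hs.trans hst)).sub (hu s hs)))
      fun n => ?_
    exact (hU n).neg_le_inner (V := fun k => G (τ n k)) (fun k => hV _ _ _ k.le_succ) hz
      (hκm hst n) (fun l hl => hV _ _ _ hl)

end ContinuousTime

section Density

theorem absolutelyContinuousOnInterval_of_norm_sub_le_integral {E : Type*}
    [SeminormedAddCommGroup E] {v : ℝ → E} {g : ℝ → ℝ} (hg : Integrable g)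
    (hv : ∀ s t, s ≤ t → ‖v t - v s‖ ≤ ∫ r in s..t, g r) (a b : ℝ) :
    AbsolutelyContinuousOnInterval v a b := by
  have hG : AbsolutelyContinuousOnInterval (fun x => ∫ r in a..x, g r) a b :=
    hg.intervalIntegrable.absolutelyContinuousOnInterval_intervalIntegral left_mem_uIcc
  have hle : ∀ s t, dist (v s) (v t) ≤ dist (∫ r in a..s, g r) (∫ r in a..t, g r) := by
    have key : ∀ s t, s ≤ t → dist (v s) (v t) ≤ dist (∫ r in a..s, g r) (∫ r in a..t, g r) := by
      intro s t hst
      rw [dist_comm (v s), dist_comm (∫ r in a..s, g r), dist_eq_norm, Real.dist_eq,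
        intervalIntegral.integral_interval_sub_left hg.intervalIntegrable hg.intervalIntegrable]
      exact (hv s t hst).trans (le_abs_self _)
    intro s t
    rcases le_total s t with h | h
    · exact key s t h
    · rw [dist_comm (v s), dist_comm (∫ r in a..s, g r)]
      exact key t s h
  exact squeeze_zero (fun _ => Finset.sum_nonneg fun _ _ => dist_nonneg)
    (fun _ => Finset.sum_le_sum fun _ _ => hle _ _) hG

theorem ae_differentiableAt_of_norm_sub_le_integral {V : Type*} [NormedAddCommGroup V]
    [NormedSpace ℝ V] [FiniteDimensional ℝ V] {v : ℝ → V} {g : ℝ → ℝ} (hg : Integrable g)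
    (hv : ∀ s t, s ≤ t → ‖v t - v s‖ ≤ ∫ r in s..t, g r) :
    ∀ᵐ t, DifferentiableAt ℝ v t := by
  refine LocallyBoundedVariationOn.ae_differentiableAt fun a b _ _ => ?_
  rw [univ_inter]
  exact (absolutelyContinuousOnInterval_of_norm_sub_le_integral hg hv a b).boundedVariationOn.mono
    Icc_subset_uIcc

theorem HasDerivAt.norm_le_of_norm_sub_le {E : Type*} [NormedAddCommGroup E] [NormedSpace ℝ E]
    {v : ℝ → E} {v' : E} {G : ℝ → ℝ} {G' t : ℝ} (hv : HasDerivAt v v' t) (hG : HasDerivAt G G' t)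
    (h : ∀ s, t ≤ s → ‖v s - v t‖ ≤ G s - G t) : ‖v'‖ ≤ G' := by
  have h1 := (hasDerivAt_iff_tendsto_slope.1 hv).mono_left (nhdsGT_le_nhdsNE t)
  have h2 := (hasDerivAt_iff_tendsto_slope.1 hG).mono_left (nhdsGT_le_nhdsNE t)
  refine le_of_tendsto_of_tendsto h1.norm h2 ?_
  filter_upwards [self_mem_nhdsWithin] with s hs
  have hs : t < s := hs
  have hpos : 0 < s - t := sub_pos.2 hs
  rw [slope_def_module, slope_def_field, norm_smul, norm_inv, Real.norm_of_nonneg hpos.le,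
    div_eq_inv_mul]
  gcongr
  exact h s hs.le

theorem ae_norm_deriv_le_of_norm_sub_le_integral {E : Type*} [NormedAddCommGroup E]
    [NormedSpace ℝ E] {v : ℝ → E} {g : ℝ → ℝ} (hg : Integrable g)
    (hv : ∀ s t, s ≤ t → ‖v t - v s‖ ≤ ∫ r in s..t, g r)
    (hd : ∀ᵐ t, DifferentiableAt ℝ v t) : ∀ᵐ t, ‖deriv v t‖ ≤ g t := by
  filter_upwards [hd, LocallyIntegrable.ae_hasDerivAt_integral hg.locallyIntegrable] with t ht hgt
  refine ht.hasDerivAt.norm_le_of_norm_sub_le (hgt 0) fun s hs => ?_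
  rw [intervalIntegral.integral_interval_sub_left hg.intervalIntegrable hg.intervalIntegrable]
  exact hv t s hs

theorem integral_deriv_eq_sub_of_norm_sub_le_integral {E : Type*} [NormedAddCommGroup E]
    [NormedSpace ℝ E] [CompleteSpace E] {v : ℝ → E} {g : ℝ → ℝ} (hg : Integrable g)
    (hv : ∀ s t, s ≤ t → ‖v t - v s‖ ≤ ∫ r in s..t, g r)
    (hd : ∀ᵐ t, DifferentiableAt ℝ v t) (a b : ℝ) : ∫ t in a..b, deriv v t = v b - v a := by
  have hle := ae_norm_deriv_le_of_norm_sub_le_integral hg hv hd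
  have hint : Integrable (deriv v) := hg.mono' (aestronglyMeasurable_deriv v _) hle
  have hac := absolutelyContinuousOnInterval_of_norm_sub_le_integral
    (v := fun t => v t - ∫ r in a..t, deriv v r) (hg.add hg) (fun s t hst => by
      have h1 : ‖∫ r in s..t, deriv v r‖ ≤ ∫ r in s..t, g r :=
        intervalIntegral.norm_integral_le_of_norm_le hst (hle.mono fun _ h _ => h)
          hg.intervalIntegrable
      have h2 := intervalIntegral.integral_interval_sub_left (f := deriv v) (μ := volume)
        (a := a) (b := t) (c := s) hint.intervalIntegrable hint.intervalIntegrable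
      rw [sub_sub_sub_comm, h2]
      simp only [Pi.add_apply]
      rw [intervalIntegral.integral_add hg.intervalIntegrable hg.intervalIntegrable]
      exact (_root_.norm_sub_le _ _).trans (add_le_add (hv s t hst) h1)) a b
  obtain ⟨C, hC⟩ := hac.const_of_ae_hasDerivAt_zero (by
    filter_upwards [hd, LocallyIntegrable.ae_hasDerivAt_integral hint.locallyIntegrable] with
      t ht hI _
    have h := ht.hasDerivAt.sub (hI a)
    rwa [sub_self] at h)
  have h1 := hC a left_mem_uIcc
  have h2 := hC b right_mem_uIcc
  simp only [intervalIntegral.integral_same, sub_zero] at h1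
  rw [h1, ← h2, sub_sub_cancel]

theorem cauchySeq_of_sq_norm_sub_eq {E : Type*} [SeminormedAddCommGroup E] {x : ℕ → E} {C : ℝ}
    (hC : ∀ n, ‖x n‖ ≤ C) (hx : ∀ m n, m ≤ n → ‖x n - x m‖ ^ 2 = ‖x n‖ ^ 2 - ‖x m‖ ^ 2) :
    CauchySeq x := by
  have hmono : Monotone fun n => ‖x n‖ ^ 2 := fun m n hmn => by
    have := hx m n hmn
    have := sq_nonneg ‖x n - x m‖
    simp only
    linarith
  have hbdd : BddAbove (range fun n => ‖x n‖ ^ 2) := by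
    refine ⟨C ^ 2, ?_⟩
    rintro _ ⟨n, rfl⟩
    exact pow_le_pow_left₀ (norm_nonneg _) (hC n) 2
  have hcau := (tendsto_atTop_ciSup hmono hbdd).cauchySeq
  rw [Metric.cauchySeq_iff'] at hcau ⊢
  intro ε hε
  obtain ⟨N, hN⟩ := hcau (ε ^ 2) (by positivity)
  refine ⟨N, fun n hn => ?_⟩
  have h1 := (le_abs_self _).trans_lt (hN n hn)
  rw [← hx N n hn] at h1
  rw [dist_eq_norm]
  exact lt_of_pow_lt_pow_left₀ 2 hε.le h1

/-- A Hilbert space valued function whose increments are controlled by the integral of an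
integrable function is an indefinite Bochner integral. -/
theorem exists_integral_eq_sub_of_norm_sub_le_integral {Y : Type*} [NormedAddCommGroup Y]
    [InnerProductSpace ℝ Y] [CompleteSpace Y] {u : ℝ → Y} {g : ℝ → ℝ} (hg : Integrable g)
    (hu : ∀ s t, s ≤ t → ‖u t - u s‖ ≤ ∫ r in s..t, g r) :
    ∃ d : ℝ → Y, AEStronglyMeasurable d ∧ (∀ᵐ t, ‖d t‖ ≤ g t) ∧
      ∀ a b, ∫ t in a..b, d t = u b - u a := by
  have hcont : Continuous u := by
    refine continuous_iff_continuousAt.2 fun t => ?_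
    have := (absolutelyContinuousOnInterval_of_norm_sub_le_integral hg hu
      (t - 1) (t + 1)).continuousOn
    refine this.continuousAt ?_
    rw [uIcc_of_le (by linarith)]
    exact Icc_mem_nhds (by simp) (by simp)
  let q := TopologicalSpace.denseSeq ℝ
  let V : ℕ → Submodule ℝ Y := fun n => Submodule.span ℝ ((fun i => u (q i)) '' Iio n)
  have hVmono : Monotone V := fun m n hmn =>
    Submodule.span_mono (image_mono (Iio_subset_Iio hmn))
  have hVfin : ∀ n, FiniteDimensional ℝ (V n) := fun n =>
    FiniteDimensional.span_of_finite ℝ ((finite_Iio n).image _)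
  have hv : ∀ n s t, s ≤ t →
      ‖(V n).orthogonalProjectionOnto (u t) - (V n).orthogonalProjectionOnto (u s)‖
        ≤ ∫ r in s..t, g r := fun n s t hst => by
    rw [← map_sub]
    exact ((V n).norm_orthogonalProjectionOnto_apply_le _).trans (hu s t hst)
  let v : ℕ → ℝ → Y := fun n t => (V n).starProjection (u t)
  have hv' : ∀ n s t, s ≤ t → ‖v n t - v n s‖ ≤ ∫ r in s..t, g r := hv
  have hd : ∀ n, ∀ᵐ t, DifferentiableAt ℝ (v n) t := fun n => by
    filter_upwards [ae_differentiableAt_of_norm_sub_le_integral hg (hv n)] with t ht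
    exact (V n).subtypeL.differentiableAt.comp t ht
  have hle : ∀ᵐ t, ∀ n, ‖deriv (v n) t‖ ≤ g t := ae_all_iff.2 fun n =>
    ae_norm_deriv_le_of_norm_sub_le_integral hg (hv' n) (hd n)
  have hproj : ∀ᵐ t, ∀ m n, m ≤ n → (V m).starProjection (deriv (v n) t) = deriv (v m) t := by
    filter_upwards [ae_all_iff.2 hd] with t ht m n hmn
    have h1 := ((V m).starProjection.hasFDerivAt.comp_hasDerivAt t (ht n).hasDerivAt).deriv
    rw [← h1]
    congr 1
    funext s
    exact (congrArg (fun P : Y →L[ℝ] Y => P (u s))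
      (Submodule.starProjection_comp_starProjection_of_le (hVmono hmn)) :)
  have hcau : ∀ᵐ t, CauchySeq fun n => deriv (v n) t := by
    filter_upwards [hle, hproj] with t hlt hpt
    refine cauchySeq_of_sq_norm_sub_eq hlt fun m n hmn => ?_
    have h1 := (V m).norm_sq_eq_add_norm_sq_starProjection (deriv (v n) t)
    rw [Submodule.starProjection_orthogonal'] at h1
    simp only [sub_apply, hpt m n hmn] at h1
    simp only [one_apply_eq_self] at h1
    linarith
  let d : ℝ → Y := fun t => limUnder atTop fun n => deriv (v n) t
  have hlim : ∀ᵐ t, Tendsto (fun n => deriv (v n) t) atTop (𝓝 (d t)) := by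
    filter_upwards [hcau] with t ht
    exact ht.tendsto_limUnder
  have hmeas : ∀ n, AEStronglyMeasurable (deriv (v n)) := fun n => aestronglyMeasurable_deriv _ _
  refine ⟨d, aestronglyMeasurable_of_tendsto_ae atTop hmeas hlim, ?_, fun a b => ?_⟩
  · filter_upwards [hlim, hle] with t ht hlt
    exact le_of_tendsto' ht.norm hlt
  · have h1 : Tendsto (fun n => ∫ t in a..b, deriv (v n) t) atTop (𝓝 (∫ t in a..b, d t)) :=
      intervalIntegral.tendsto_integral_filter_of_dominated_convergence g
        (.of_forall fun n => (hmeas n).restrict)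
        (.of_forall fun n => hle.mono fun t h _ => h n) hg.intervalIntegrable
        (hlim.mono fun t h _ => h)
    have h2 : ∀ t, Tendsto (fun n => v n t) atTop (𝓝 (u t)) := fun t => by
      rw [Metric.tendsto_atTop]
      intro ε hε
      have hev : ∀ᶠ s in 𝓝 t, dist (u t) (u s) < ε := by
        have := (hcont.tendsto t).eventually (Metric.ball_mem_nhds (u t) hε)
        exact this.mono fun s hs => by rw [dist_comm]; exact hs
      obtain ⟨i, hs⟩ := (TopologicalSpace.denseRange_denseSeq ℝ).exists_mem_open isOpen_interior
        ⟨t, mem_interior_iff_mem_nhds.2 hev⟩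
      replace hs := interior_subset hs
      refine ⟨i + 1, fun n hn => ?_⟩
      have hmem : u (q i) ∈ V n := Submodule.subset_span ⟨i, Nat.lt_of_succ_le hn, rfl⟩
      rw [dist_comm, dist_eq_norm, (V n).starProjection_minimal]
      refine lt_of_le_of_lt (ciInf_le ⟨0, ?_⟩ ⟨u (q i), hmem⟩) ?_
      · rintro _ ⟨x, rfl⟩
        exact norm_nonneg _
      · rw [← dist_eq_norm]
        exact hs
    refine tendsto_nhds_unique h1 ?_
    simp_rw [integral_deriv_eq_sub_of_norm_sub_le_integral hg (hv' _) (hd _)]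
    exact (h2 b).sub (h2 a)

end Density

section Play

variable {Y : Type*} [NormedAddCommGroup Y] [InnerProductSpace ℝ Y] [CompleteSpace Y]

/-- Existence for the play operator with characteristic set `K` and absolutely continuous
input. -/
theorem exists_play_integral {K : Set Y} (hKc : IsClosed K) (hK : Convex ℝ K)
    {F dF : ℝ → Y} (hdF : Integrable dF) (hF : ∀ t, F t = F 0 + ∫ s in (0 : ℝ)..t, dF s) (u₀ : Y)
    (h₀ : F 0 - u₀ ∈ K) :
    ∃ u du : ℝ → Y, u 0 = u₀ ∧ AEStronglyMeasurable du ∧ (∀ᵐ t, ‖du t‖ ≤ ‖dF t‖) ∧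
      (∀ t, u t = u 0 + ∫ s in (0 : ℝ)..t, du s) ∧ (∀ t, 0 ≤ t → F t - u t ∈ K) ∧
      ∀ᵐ t, 0 < t → ∀ z ∈ K, 0 ≤ inner ℝ (F t - u t - z) (du t) := by
  let G : ℝ → ℝ := fun t => ∫ s in (0 : ℝ)..t, ‖dF s‖
  have hGint : ∀ a b, IntervalIntegrable (fun s => ‖dF s‖) volume a b := fun a b =>
    hdF.norm.intervalIntegrable
  have hGsub : ∀ s t, G t - G s = ∫ r in s..t, ‖dF r‖ := fun s t =>
    intervalIntegral.integral_interval_sub_left (hGint _ _) (hGint _ _)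
  have hGm : Monotone G := fun s t hst => by
    have := intervalIntegral.integral_nonneg (μ := volume) (f := fun r => ‖dF r‖) hst
      fun r _ => norm_nonneg _
    linarith [hGsub s t]
  have hGc : Continuous G := intervalIntegral.continuous_primitive hGint 0
  have hFG : ∀ s t, s ≤ t → ‖F t - F s‖ ≤ G t - G s := fun s t hst => by
    rw [hF t, hF s, add_sub_add_left_eq_sub, intervalIntegral.integral_interval_sub_left
      hdF.intervalIntegrable hdF.intervalIntegrable, hGsub]
    exact intervalIntegral.norm_integral_le_integral_norm hst
  obtain ⟨u, hu0, hmem, hu, hinner⟩ := exists_play hKc hK hGc hFG u₀ h₀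
  have hbound : ∀ s t, s ≤ t → ‖u (max t 0) - u (max s 0)‖ ≤ ∫ r in s..t, ‖dF r‖ := by
    intro s t hst
    refine (hu _ _ (le_max_right _ _) (max_le_max_right 0 hst)).trans ?_
    rw [← hGsub]
    rcases le_total s 0 with hs | hs
    · rcases le_total t 0 with ht | ht
      · rw [max_eq_right hs, max_eq_right ht, sub_self]
        exact sub_nonneg.2 (hGm hst)
      · rw [max_eq_right hs, max_eq_left ht]
        exact sub_le_sub_left (hGm hs) _
    · rw [max_eq_left hs, max_eq_left (hs.trans hst)]
  obtain ⟨d, hdm, hdle, hd⟩ := exists_integral_eq_sub_of_norm_sub_le_integral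
    (u := fun t => u (max t 0)) hdF.norm hbound
  have hdint : Integrable d := hdF.norm.mono' hdm hdle
  refine ⟨fun t => u (max t 0), d, by simpa using hu0, hdm, hdle, fun t => ?_, fun t ht => ?_, ?_⟩
  · rw [hd]; abel
  · simpa [ht] using hmem t ht
  · filter_upwards [LocallyIntegrable.ae_hasDerivAt_integral hdint.locallyIntegrable,
      LocallyIntegrable.ae_hasDerivAt_integral hdF.norm.locallyIntegrable] with t hdt hGt ht z hz
    have hder : HasDerivAt (fun t => u (max t 0)) (d t) t := by
      have := (hdt 0).add_const (u (max 0 0))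
      refine this.congr_of_eventuallyEq (.of_forall fun s => ?_)
      simp only [hd]
      abel
    have h1 := (hasDerivAt_iff_tendsto_slope.1 hder).mono_left (nhdsGT_le_nhdsNE t)
    have h2 := (hasDerivAt_iff_tendsto_slope.1 (hGt 0)).mono_left (nhdsGT_le_nhdsNE t)
    have h3 : Tendsto (fun s => G s - G t) (𝓝[>] t) (𝓝 0) := by
      have : Continuous fun s => G s - G t := by fun_prop
      simpa using (this.tendsto t).mono_left nhdsWithin_le_nhds
    have h4 : Tendsto (fun s => -(2 * (slope G t s * (G s - G t)))) (𝓝[>] t) (𝓝 0) := by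
      simpa using ((h2.mul h3).const_mul 2).neg
    simp only [max_eq_left ht.le]
    refine le_of_tendsto_of_tendsto h4 (tendsto_const_nhds.inner h1) ?_
    filter_upwards [self_mem_nhdsWithin] with s hs
    have hs : t < s := hs
    have hpos : 0 < s - t := sub_pos.2 hs
    simp only [slope_def_module, smul_eq_mul, inner_smul_right, max_eq_left ht.le,
      max_eq_left (ht.le.trans hs.le)]
    have h5 := mul_le_mul_of_nonneg_left (hinner t s ht.le hs.le z hz) (inv_nonneg.2 hpos.le)
    refine le_trans (le_of_eq ?_) h5
    field_simp

end Play

section Energy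

/-- A copy of the vector space `X` without its norm, meant to carry another inner product. -/
def EnergySpace (X : Type*) : Type _ := X

instance {X : Type*} [AddCommGroup X] : AddCommGroup (EnergySpace X) :=
  inferInstanceAs (AddCommGroup X)

instance {X : Type*} [AddCommGroup X] [Module ℝ X] : Module ℝ (EnergySpace X) :=
  inferInstanceAs (Module ℝ X)

/-- An admissible form is the inner product of an equivalent Hilbert space structure. -/
theorem AdmissibleForm.exists_continuousLinearEquiv.{v} {X : Type v} [NormedAddCommGroup X]
    [InnerProductSpace ℝ X] [CompleteSpace X] {m M : ℝ} (hm : 0 < m) {a : X → X → ℝ}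
    (ha : AdmissibleForm m M a) :
    ∃ (Y : Type v) (_ : NormedAddCommGroup Y) (_ : InnerProductSpace ℝ Y) (_ : CompleteSpace Y)
      (L : X ≃L[ℝ] Y), ∀ x y, inner ℝ (L x) (L y) = a x y := by
  obtain ⟨hsymm, hadd, hsmul, hcoer, hbdd⟩ := ha
  have hdef : ∀ x : X, a x x = 0 → x = 0 := fun x hx => by
    have h1 := hcoer x
    have h3 : ‖x‖ ^ 2 ≤ 0 := by
      by_contra! h
      have := mul_pos hm h
      linarith
    exact norm_eq_zero.1 (pow_eq_zero_iff two_ne_zero |>.1 (le_antisymm h3 (sq_nonneg _)))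
  let c : InnerProductSpace.Core ℝ (EnergySpace X) :=
    { inner := a
      conj_inner_symm := fun x y => hsymm y x
      re_inner_nonneg := fun x => le_trans (by positivity) (hcoer x)
      add_left := hadd
      smul_left := fun x y r => hsmul r x y
      definite := hdef }
  let : NormedAddCommGroup (EnergySpace X) := c.toNormedAddCommGroup
  let : InnerProductSpace ℝ (EnergySpace X) := InnerProductSpace.ofCore c.toCore
  let e : X ≃ₗ[ℝ] EnergySpace X := LinearEquiv.refl ℝ X
  have he : ∀ x y, inner ℝ (e x) (e y) = a x y := fun x y => rfl
  have hsq : ∀ x, ‖e x‖ ^ 2 = a x x := fun x => by rw [← real_inner_self_eq_norm_sq, he]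
  have h1 : ∀ x, ‖e x‖ ≤ √M * ‖x‖ := fun x => by
    rw [← Real.sqrt_sq (norm_nonneg (e x)), hsq, ← Real.sqrt_sq (norm_nonneg x),
      ← Real.sqrt_mul' _ (sq_nonneg _)]
    refine Real.sqrt_le_sqrt ((le_abs_self _).trans ((hbdd x x).trans_eq ?_))
    ring
  have h2 : ∀ y, ‖e.symm y‖ ≤ √(m⁻¹) * ‖y‖ := fun y => by
    obtain ⟨x, rfl⟩ := e.surjective y
    rw [e.symm_apply_apply, ← Real.sqrt_sq (norm_nonneg x), ← Real.sqrt_sq (norm_nonneg (e x)),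
      hsq, ← Real.sqrt_mul (by positivity)]
    refine Real.sqrt_le_sqrt ?_
    rw [inv_mul_eq_div, le_div_iff₀ hm, mul_comm]
    exact hcoer x
  let L : X ≃L[ℝ] EnergySpace X := e.toContinuousLinearEquivOfBounds _ _ h1 h2
  exact ⟨EnergySpace X, inferInstance, inferInstance,
    (completeSpace_congr (e := L.toEquiv) L.isUniformEmbedding).1 inferInstance, L, he⟩

end Energy

section Functional

variable {X : Type*} [NormedAddCommGroup X] [InnerProductSpace ℝ X] {j : X → ℝ}

theorem AdmissibleJ.map_zero (hj : AdmissibleJ j) : j 0 = 0 := by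
  simpa using hj.2.2.1 0 0

theorem AdmissibleJ.add_le (hj : AdmissibleJ j) (x y : X) : j (x + y) ≤ j x + j y := by
  have h1 := hj.2.1.2 (mem_univ x) (mem_univ y) (by norm_num : (0 : ℝ) ≤ 1 / 2)
    (by norm_num : (0 : ℝ) ≤ 1 / 2) (by norm_num)
  rw [← smul_add, hj.2.2.1, abs_of_pos (by norm_num), smul_eq_mul, smul_eq_mul] at h1
  linarith

theorem AdmissibleJ.comp_continuousLinearMap (hj : AdmissibleJ j) {Y : Type*}
    [NormedAddCommGroup Y] [InnerProductSpace ℝ Y] (L : Y →L[ℝ] X) :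
    AdmissibleJ fun y => j (L y) := by
  obtain ⟨h0, hconv, hhom, C, hC⟩ := hj
  refine ⟨fun y => h0 _, ?_, fun c y => ?_, _, hC.comp L.lipschitz⟩
  · have h := hconv.comp_linearMap L.toLinearMap
    rwa [preimage_univ] at h
  · dsimp only
    rw [map_smul, hhom]

/-- An admissible functional is the support function of its subdifferential at the origin. -/
theorem AdmissibleJ.exists_inner_eq [CompleteSpace X] (hj : AdmissibleJ j) (v : X) :
    ∃ w : X, (∀ x, inner ℝ w x ≤ j x) ∧ inner ℝ w v = j v := by
  rcases eq_or_ne v 0 with rfl | hv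
  · exact ⟨0, fun x => by simpa using hj.1 x, by simp [hj.map_zero]⟩
  obtain ⟨g, hg, hgj⟩ := exists_extension_of_le_sublinear
    (LinearPMap.mkSpanSingleton v (j v) hv) j
    (fun c hc x => by rw [hj.2.2.1, abs_of_pos hc]) hj.add_le (by
      rintro ⟨x, hx⟩
      obtain ⟨c, rfl⟩ := Submodule.mem_span_singleton.1 hx
      rw [LinearPMap.mkSpanSingleton'_apply, hj.2.2.1, smul_eq_mul]
      exact mul_le_mul_of_nonneg_right (le_abs_self c) (hj.1 v))
  obtain ⟨C, hC⟩ := hj.2.2.2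
  have hjC : ∀ x, j x ≤ C * ‖x‖ := fun x => by
    have := (le_abs_self _).trans (hC.dist_le_mul x 0)
    rwa [hj.map_zero, sub_zero, dist_zero_right] at this
  have hgC : ∀ x, ‖g x‖ ≤ C * ‖x‖ := fun x => by
    rw [Real.norm_eq_abs, abs_le]
    have h1 := (hgj (-x)).trans (hjC (-x))
    rw [map_neg, norm_neg] at h1
    exact ⟨by linarith, (hgj x).trans (hjC x)⟩
  refine ⟨(InnerProductSpace.toDual ℝ X).symm (g.mkContinuous C hgC), fun x => ?_, ?_⟩
  · rw [InnerProductSpace.toDual_symm_apply]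
    exact hgj x
  · rw [InnerProductSpace.toDual_symm_apply]
    have := hg ⟨v, Submodule.mem_span_singleton_self v⟩
    rw [LinearPMap.mkSpanSingleton_apply] at this
    exact this

end Functional

/-- The Riesz map of a Hilbert space structure equivalent to the given one. -/
theorem exists_continuousLinearMap_inner_eq {X Y : Type*} [NormedAddCommGroup X]
    [NormedSpace ℝ X] [NormedAddCommGroup Y] [InnerProductSpace ℝ Y] [CompleteSpace Y]
    (L : X ≃L[ℝ] Y) :
    ∃ R : (X →L[ℝ] ℝ) →L[ℝ] Y, ∀ φ v, inner ℝ (R φ) (L v) = φ v := by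
  let R : (X →L[ℝ] ℝ) →ₗ[ℝ] Y :=
    { toFun := fun φ => (InnerProductSpace.toDual ℝ Y).symm (φ.comp (L.symm : Y →L[ℝ] X))
      map_add' := fun φ ψ => by rw [ContinuousLinearMap.add_comp, map_add]
      map_smul' := fun c φ => by
        rw [ContinuousLinearMap.smul_comp, LinearIsometryEquiv.map_smulₛₗ]
        simp }
  refine ⟨R.mkContinuous ‖(L.symm : Y →L[ℝ] X)‖ fun φ => ?_, fun φ v => ?_⟩
  · rw [mul_comm]
    exact ((InnerProductSpace.toDual ℝ Y).symm.norm_map _).trans_le (φ.opNorm_comp_le _)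
  · refine InnerProductSpace.toDual_symm_apply.trans ?_
    simp

/-- Existence of a solution of the quasistatic variational inequality. -/
theorem existence_of_solution
    {X : Type*} [NormedAddCommGroup X] [InnerProductSpace ℝ X] [CompleteSpace X]
    (T : ℝ) (hT : 0 < T) (p : ℝ≥0∞) (hp : 1 ≤ p)
    (m M : ℝ) (hm : 0 < m) (hmM : m ≤ M)
    (a : X → X → ℝ) (ha : AdmissibleForm m M a)
    (j : X → ℝ) (hj : AdmissibleJ j)
    (f df : ℝ → (X →L[ℝ] ℝ)) (hf : MemW1p T p f df)
    (ustar : X) (hstar : ∀ v : X, a ustar v + j v ≥ (f 0) v) :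
    ∃ u du : ℝ → X, IsQVISol T p a j f ustar u du := by
  obtain ⟨Y, _, _, _, L, hL⟩ := ha.exists_continuousLinearEquiv hm
  have haL : ∀ x y, inner ℝ x (L y) = a (L.symm x) y := fun x y => by
    rw [← hL, L.apply_symm_apply]
  have hJ : AdmissibleJ fun y => j (L.symm y) := hj.comp_continuousLinearMap (L.symm : Y →L[ℝ] X)
  obtain ⟨R, hR⟩ := exists_continuousLinearMap_inner_eq L
  let K : Set Y := {w | ∀ y, inner ℝ w y ≤ j (L.symm y)}
  have hKc : IsClosed K := by
    simp only [K, ofPred_forall]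
    exact isClosed_iInter fun y => isClosed_le (by fun_prop) continuous_const
  have hK : Convex ℝ K := fun w hw z hz α β hα hβ hαβ y => by
    rw [inner_add_left, real_inner_smul_left, real_inner_smul_left]
    calc α * inner ℝ w y + β * inner ℝ z y
        ≤ α * j (L.symm y) + β * j (L.symm y) :=
          add_le_add (mul_le_mul_of_nonneg_left (hw y) hα) (mul_le_mul_of_nonneg_left (hz y) hβ)
      _ = j (L.symm y) := by rw [← add_mul, hαβ, one_mul]
  obtain ⟨hdfm, hdfp, hf⟩ := hf
  have hdfint : Integrable ((Ioo 0 T).indicator df) :=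
    (integrable_indicator_iff measurableSet_Ioo).2 (MemLp.integrable hp ⟨hdfm, hdfp⟩)
  let dF : ℝ → Y := fun t => R ((Ioo 0 T).indicator df t)
  have hdF : Integrable dF := R.integrable_comp hdfint
  let F : ℝ → Y := fun t => R (f 0) + ∫ s in (0 : ℝ)..t, dF s
  have hF0 : F 0 = R (f 0) := by simp [F]
  have hFf : ∀ t ∈ Ioo 0 T, F t = R (f t) := fun t ht => by
    have h1 : ∫ s in (0 : ℝ)..t, (Ioo 0 T).indicator df s = ∫ s in (0 : ℝ)..t, df s := by
      refine intervalIntegral.integral_congr_uIoo fun s hs => ?_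
      rw [uIoo_of_le ht.1.le] at hs
      have hsT : s ∈ Ioo 0 T := ⟨hs.1, hs.2.trans ht.2⟩
      exact indicator_of_mem hsT _
    rw [hf t (Ioo_subset_Icc_self ht), map_add, ← h1,
      ← R.intervalIntegral_comp_comm hdfint.intervalIntegrable]
  obtain ⟨u, du, hu0, hdum, hdule, hu, hmem, hvi⟩ := exists_play_integral (F := F)
    hKc hK hdF (fun t => by rw [hF0]) (L ustar) (fun y => by
      rw [hF0, inner_sub_left, ← L.apply_symm_apply y, hR, hL, L.symm_apply_apply]
      linarith [hstar (L.symm y)])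
  have hduint : Integrable du := hdF.norm.mono' hdum hdule
  refine ⟨fun t => L.symm (u t), fun t => L.symm (du t), ⟨?_, ?_, fun t _ => ?_⟩, ?_, ?_⟩
  · exact (L.symm.continuous.comp_aestronglyMeasurable hdum).restrict
  · have hle : ∀ᵐ t ∂(volume.restrict (Ioo 0 T)),
        ‖L.symm (du t)‖ ≤ ‖(L.symm : Y →L[ℝ] X)‖ * ‖R‖ * ‖df t‖ := by
      filter_upwards [ae_restrict_of_ae hdule, ae_restrict_mem measurableSet_Ioo] with t ht htT
      have h1 : ‖dF t‖ ≤ ‖R‖ * ‖df t‖ := by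
        simp only [dF, indicator_of_mem htT]
        exact R.le_opNorm _
      rw [mul_assoc]
      exact ((L.symm : Y →L[ℝ] X).le_opNorm _).trans
        (mul_le_mul_of_nonneg_left (ht.trans h1) (norm_nonneg _))
    exact (eLpNorm_le_mul_eLpNorm_of_ae_le_mul hle p).trans_lt
      (ENNReal.mul_lt_top ENNReal.ofReal_lt_top hdfp)
  · have h1 := (L.symm : Y →L[ℝ] X).intervalIntegral_comp_comm
      (hduint.intervalIntegrable (a := 0) (b := t))
    simp only [ContinuousLinearEquiv.coe_coe] at h1
    rw [h1, ← map_add, ← hu t]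
  · dsimp only
    rw [hu0, L.symm_apply_apply]
  · filter_upwards [ae_restrict_of_ae hvi, ae_restrict_mem measurableSet_Ioo] with t ht htT v
    obtain ⟨z, hz, hzdu⟩ := hJ.exists_inner_eq (du t)
    have h1 := ht htT.1 z hz
    have h2 := hmem t htT.1.le (L v)
    rw [L.symm_apply_apply] at h2
    rw [inner_sub_left, hzdu, hFf t htT] at h1
    rw [hFf t htT] at h2
    have h3 : L v - du t = L (v - L.symm (du t)) := by rw [map_sub, L.apply_symm_apply]
    have h4 := haL (u t) (v - L.symm (du t))
    have h5 := hR (f t) (v - L.symm (du t))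
    have h6 : inner ℝ (R (f t) - u t) (L v - du t) =
        f t (v - L.symm (du t)) - a (L.symm (u t)) (v - L.symm (du t)) := by
      rw [h3, inner_sub_left, h4, h5]
    rw [inner_sub_right] at h6
    linarith
end
end

section
/- Let X be a real Hilbert space, T > 0, I = (0,T), and 1 ≤ p ≤ ∞. Let 0 < m ≤ M, let a be an admissible bilinear form, j an admissible functional, f ∈ W^{1,p}(I;X*) with derivative ḟ, and let u_* ∈ X satisfy a(u_*, v) + j(v) ≥ ⟨f(0), v⟩ for all v ∈ X. If u₁ and u₂ are both solutions of the quasistatic variational inequality with data (a, j, f, u_*), then u₁(t) = u₂(t) for every t ∈ [0,T]. -/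
open MeasureTheory Set Filter
open scoped ENNReal NNReal Topology

noncomputable section

/-- A function whose increments are controlled by those of an absolutely continuous function is
absolutely continuous. -/
theorem AbsolutelyContinuousOnInterval.of_dist_le {E F : Type*} [PseudoMetricSpace E]
    [SeminormedAddCommGroup F] {f : ℝ → E} {g : ℝ → F} {a b K : ℝ}
    (hg : AbsolutelyContinuousOnInterval g a b)
    (h : ∀ x ∈ uIcc a b, ∀ y ∈ uIcc a b, dist (f x) (f y) ≤ K * dist (g x) (g y)) :
    AbsolutelyContinuousOnInterval f a b := by
  unfold AbsolutelyContinuousOnInterval at hg ⊢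
  refine squeeze_zero' (Eventually.of_forall fun E => Finset.sum_nonneg fun i _ => dist_nonneg) ?_
    (by simpa using hg.const_mul K)
  filter_upwards [mem_inf_of_right (mem_principal_self _)] with E hE
  rw [Finset.mul_sum]
  exact Finset.sum_le_sum fun i hi => h _ (hE.1 i hi).1 _ (hE.1 i hi).2

/-- The Bochner integral of an interval integrable function is absolutely continuous. -/
theorem IntervalIntegrable.absolutelyContinuousOnInterval_integral {E : Type*}
    [NormedAddCommGroup E] [NormedSpace ℝ E] {g : ℝ → E} {a b : ℝ}
    (hg : IntervalIntegrable g volume a b) :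
    AbsolutelyContinuousOnInterval (fun x => ∫ s in a..x, g s) a b := by
  refine (hg.norm.absolutelyContinuousOnInterval_intervalIntegral
    left_mem_uIcc).of_dist_le (K := 1) fun x hx y hy => ?_
  have hix := hg.mono_set (uIcc_subset_uIcc_left hx)
  have hiy := hg.mono_set (uIcc_subset_uIcc_left hy)
  rw [one_mul, dist_eq_norm, dist_eq_norm, intervalIntegral.integral_interval_sub_left hix hiy,
    intervalIntegral.integral_interval_sub_left hix.norm hiy.norm, Real.norm_eq_abs]
  exact intervalIntegral.norm_integral_le_abs_integral_norm

/-- A quadratic form evaluated along an absolutely continuous function is absolutely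
continuous. -/
theorem AbsolutelyContinuousOnInterval.clm_apply_self {E : Type*} [NormedAddCommGroup E]
    [NormedSpace ℝ E] {w : ℝ → E} {a b : ℝ} (hw : AbsolutelyContinuousOnInterval w a b)
    (B : E →L[ℝ] E →L[ℝ] ℝ) :
    AbsolutelyContinuousOnInterval (fun x => B (w x) (w x)) a b := by
  obtain ⟨C, hC⟩ := hw.exists_bound
  refine hw.of_dist_le (K := 2 * ‖B‖ * C) fun x hx y hy => ?_
  have hsplit : B (w x) (w x) - B (w y) (w y) =
      B (w x) (w x - w y) + B (w x - w y) (w y) := by simp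
  rw [dist_eq_norm, dist_eq_norm, hsplit]
  have hle₁ : ‖B (w x) (w x - w y)‖ ≤ ‖B‖ * C * ‖w x - w y‖ :=
    (B.le_opNorm₂ _ _).trans (by gcongr; exact hC x hx)
  have hle₂ : ‖B (w x - w y) (w y)‖ ≤ ‖B‖ * ‖w x - w y‖ * C :=
    (B.le_opNorm₂ _ _).trans (by gcongr; exact hC y hy)
  linarith [norm_add_le (B (w x) (w x - w y)) (B (w x - w y) (w y))]

/-- If `w` is the primitive of `g` vanishing at `0` and `B(w, g) ≤ 0` almost everywhere for a
symmetric bounded bilinear form `B`, then `B(w, w) ≤ 0`. -/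
theorem clm_apply_integral_self_nonpos {E : Type*} [NormedAddCommGroup E] [NormedSpace ℝ E]
    [CompleteSpace E] (B : E →L[ℝ] E →L[ℝ] ℝ) (hB : ∀ v w, B v w = B w v) {g : ℝ → E} {T : ℝ}
    (hg : IntervalIntegrable g volume 0 T)
    (h : ∀ᵐ t ∂volume.restrict (Ioo 0 T), B (∫ s in 0..t, g s) (g t) ≤ 0)
    {t : ℝ} (ht : t ∈ Icc 0 T) :
    B (∫ s in 0..t, g s) (∫ s in 0..t, g s) ≤ 0 := by
  have hT : 0 ≤ T := ht.1.trans ht.2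
  have hac := (hg.absolutelyContinuousOnInterval_integral.clm_apply_self B).mono
    (uIcc_subset_uIcc_left (by rwa [uIcc_of_le hT]) : uIcc 0 t ⊆ uIcc 0 T)
  have hint := hac.integral_deriv_eq_sub
  simp only [intervalIntegral.integral_same, map_zero, sub_zero] at hint
  rw [← hint, intervalIntegral.integral_of_le ht.1, integral_Ioc_eq_integral_Ioo]
  refine integral_nonpos_of_ae ?_
  have hIoo : Ioo 0 t ⊆ Ioo 0 T := Ioo_subset_Ioo_right ht.2
  filter_upwards [ae_mono (Measure.restrict_mono_set _ hIoo) h,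
    ae_restrict_of_ae hg.ae_hasDerivAt_integral, ae_restrict_mem measurableSet_Ioo]
    with x hle hderiv hx
  have hw := hderiv (by rw [uIcc_of_le hT]; exact Ioo_subset_Icc_self (hIoo hx)) 0 left_mem_uIcc
  have hBw := (B.hasFDerivAt.comp_hasDerivAt x hw).clm_apply hw
  simp only [Function.comp_apply] at hBw
  rw [hBw.deriv, hB (g x)]
  simp only [Pi.zero_apply]
  linarith

theorem MemW1p.intervalIntegrable {E : Type*} [NormedAddCommGroup E] [NormedSpace ℝ E]
    {T : ℝ} {p : ℝ≥0∞} {u du : ℝ → E} (h : MemW1p T p u du) (hT : 0 ≤ T) (hp : 1 ≤ p) :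
    IntervalIntegrable du volume 0 T := by
  rw [intervalIntegrable_iff_integrableOn_Ioo_of_le hT]
  exact MemLp.integrable hp ⟨h.1, h.2.1⟩

theorem AdmissibleForm.exists_clm {X : Type*} [NormedAddCommGroup X] [InnerProductSpace ℝ X]
    {m M : ℝ} {a : X → X → ℝ} (ha : AdmissibleForm m M a) :
    ∃ B : X →L[ℝ] X →L[ℝ] ℝ, ∀ v w, B v w = a v w := by
  obtain ⟨hsymm, hadd, hsmul, -, hbound⟩ := ha
  refine ⟨(LinearMap.mk₂ ℝ a hadd hsmul (fun v w z => ?_) (fun c v w => ?_)).mkContinuous₂ M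
    (fun v w => hbound v w), fun v w => rfl⟩
  · rw [hsymm, hadd, hsymm w, hsymm z]
  · rw [hsymm, hsmul, hsymm w, smul_eq_mul]

/-- Uniqueness of the solution of the quasistatic variational inequality. -/
theorem uniqueness_of_solution
    {X : Type*} [NormedAddCommGroup X] [InnerProductSpace ℝ X] [CompleteSpace X]
    (T : ℝ) (hT : 0 < T) (p : ℝ≥0∞) (hp : 1 ≤ p)
    (m M : ℝ) (hm : 0 < m) (hmM : m ≤ M)
    (a : X → X → ℝ) (ha : AdmissibleForm m M a)
    (j : X → ℝ) (hj : AdmissibleJ j)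
    (f df : ℝ → (X →L[ℝ] ℝ)) (hf : MemW1p T p f df)
    (ustar : X) (hstar : ∀ v : X, a ustar v + j v ≥ (f 0) v)
    (u₁ du₁ u₂ du₂ : ℝ → X)
    (h₁ : IsQVISol T p a j f ustar u₁ du₁)
    (h₂ : IsQVISol T p a j f ustar u₂ du₂) :
    ∀ t ∈ Icc (0 : ℝ) T, u₁ t = u₂ t := by
  obtain ⟨B, hBa⟩ := ha.exists_clm
  obtain ⟨hsymm, -, -, hcoer, -⟩ := ha
  simp only [← hBa] at hsymm hcoer
  obtain ⟨hu₁, hu₁0, hvi₁⟩ := h₁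
  obtain ⟨hu₂, hu₂0, hvi₂⟩ := h₂
  have hi₁ := hu₁.intervalIntegrable hT.le hp
  have hi₂ := hu₂.intervalIntegrable hT.le hp
  have hdiff : ∀ t ∈ Icc 0 T, ∫ s in 0..t, (du₁ s - du₂ s) = u₁ t - u₂ t := by
    intro t ht
    have hsub : uIcc 0 t ⊆ uIcc 0 T := uIcc_subset_uIcc_left (by rwa [uIcc_of_le hT.le])
    rw [hu₁.2.2 t ht, hu₂.2.2 t ht, hu₁0, hu₂0, add_sub_add_left_eq_sub,
      intervalIntegral.integral_sub (hi₁.mono_set hsub) (hi₂.mono_set hsub)]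
  intro t ht
  have hnonpos := clm_apply_integral_self_nonpos B hsymm (hi₁.sub hi₂) (by
    filter_upwards [hvi₁, hvi₂, ae_restrict_mem measurableSet_Ioo] with s hs₁ hs₂ hs
    have hineq₁ := hs₁ (du₂ s)
    have hineq₂ := hs₂ (du₁ s)
    rw [hdiff s (Ioo_subset_Icc_self hs)]
    simp only [← hBa, map_sub, sub_apply] at hineq₁ hineq₂ ⊢
    linarith) ht
  rw [hdiff t ht] at hnonpos
  have hsq : ‖u₁ t - u₂ t‖ ^ 2 ≤ 0 :=
    nonpos_of_mul_nonpos_right ((hcoer _).trans hnonpos) hm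
  exact sub_eq_zero.mp (norm_eq_zero.mp (pow_eq_zero_iff two_ne_zero |>.mp
    (le_antisymm hsq (sq_nonneg _))))
end
end

section
/- Let X be a real Hilbert space, T > 0, I = (0,T), 1 ≤ p ≤ ∞. Let 0 < m ≤ M, let a₁ and a₂ be admissible bilinear forms, j an admissible functional, X₀ ⊆ X a linear subspace with j(v + w) = j(v) for all v ∈ X and w ∈ X₀, and f : (0,T) → X*. Let u₁ be a solution of the quasistatic variational inequality with data (a₁, j, f, u₁(0)) with derivative u̇₁, let u₂ be a solution with data (a₂, j, f, u₂(0)) with derivative u̇₂, and let z ∈ W^{1,p}(I;X) with derivative ż satisfying ż(t) ∈ X₀ for a.e. t ∈ I. Set ẇ(t) = u̇₁(t) − u̇₂(t) − ż(t). Then for a.e. t ∈ I: a₁(u₁(t), ẇ(t)) ≤ a₂(u₂(t), ẇ(t)). -/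
open MeasureTheory Set Filter
open scoped ENNReal NNReal Topology

noncomputable section

/-- Key comparison inequality: if `u₁`, `u₂` solve the quasistatic variational
inequalities with forms `a₁`, `a₂` and the same `j`, `f`, and `ż(t) ∈ X₀` a.e.,
then with `ẇ = u̇₁ − u̇₂ − ż` one has `a₁(u₁(t), ẇ(t)) ≤ a₂(u₂(t), ẇ(t))` a.e. -/
theorem comparison_inequality
    {X : Type*} [NormedAddCommGroup X] [InnerProductSpace ℝ X] [CompleteSpace X]
    (T : ℝ) (hT : 0 < T) (p : ℝ≥0∞) (hp : 1 ≤ p)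
    (m M : ℝ) (hm : 0 < m) (hmM : m ≤ M)
    (a₁ a₂ : X → X → ℝ)
    (ha₁ : AdmissibleForm m M a₁) (ha₂ : AdmissibleForm m M a₂)
    (j : X → ℝ) (hj : AdmissibleJ j)
    (X₀ : Submodule ℝ X) (hj0 : ∀ v : X, ∀ w ∈ X₀, j (v + w) = j v)
    (f : ℝ → (X →L[ℝ] ℝ))
    (u₁ du₁ : ℝ → X) (h₁ : IsQVISol T p a₁ j f (u₁ 0) u₁ du₁)
    (u₂ du₂ : ℝ → X) (h₂ : IsQVISol T p a₂ j f (u₂ 0) u₂ du₂)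
    (z dz : ℝ → X) (hz : MemW1p T p z dz)
    (hdz : ∀ᵐ t ∂(volume.restrict (Ioo (0 : ℝ) T)), dz t ∈ X₀) :
    ∀ᵐ t ∂(volume.restrict (Ioo (0 : ℝ) T)),
      a₁ (u₁ t) (du₁ t - du₂ t - dz t) ≤ a₂ (u₂ t) (du₁ t - du₂ t - dz t) := by
  obtain ⟨hsymm, -, hsmul, -, -⟩ := ha₁
  filter_upwards [h₁.2.2, h₂.2.2, hdz] with t h1 h2 hd
  have e1 := h1 (du₂ t + dz t)
  have e2 := h2 (du₁ t + -dz t)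
  rw [hj0 _ _ hd,
    show du₂ t + dz t - du₁ t = (-1 : ℝ) • (du₁ t - du₂ t - dz t) by module,
    hsymm, hsmul, hsymm, map_smul, smul_eq_mul] at e1
  rw [hj0 _ _ (X₀.neg_mem hd),
    show du₁ t + -dz t - du₂ t = du₁ t - du₂ t - dz t by module] at e2
  linarith
end
end
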